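/- Let G be a finite group, let (X, X') be an r-encoding pair of G-modules and let (Y, Y') be an s-encoding pair of G-modules. Then: (a) (X', X) is a (−r)-encoding pair; (b) if r = s, then (X ⊕ Y, X' ⊕ Y') is an r-encoding pair; (c) (X ⊗_ℤ Y, X' ⊗_ℤ Y') is an (r+s)-encoding pair; (d) if X' = Y, then (X, Y') is an (r+s)-encoding pair. -/

import Mathlib

/-!
This file sets up Tate cohomology of a finite group `G` (with coefficients in objects of
`Rep ℤ G`), realized concretely in each degree `n ∈ ℤ` as
`Ĥ^n(G, M) = Ĥ⁰(G, Hom_ℤ(J n, M))`, where `J n` is the standard `n`-th syzygy of the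
trivial module `ℤ` (the `n`-th tensor power of the augmentation ideal `I_G` for `n ≥ 0`,
and of its `ℤ`-linear dual for `n < 0`), and `Ĥ⁰` denotes invariants modulo norms.
Cup products are induced by the canonical comparison maps `J (i+j) ⟶ J i ⊗ J j`.
-/

open CategoryTheory MonoidalCategory TensorProduct

set_option linter.unusedSectionVars false
set_option maxHeartbeats 1000000

attribute [instance 0] AddCommGroup.toIntModule

namespace Enc

variable {k : Type} [CommRing k] {G : Type} [Group G] [Fintype G]

/-! ### Degree-zero Tate cohomology: invariants modulo norms -/

section Aux
variable {V V₂ : Type} [AddCommGroup V] [Module k V] [AddCommGroup V₂] [Module k V₂]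

/-- The norm map `v ↦ ∑_{g ∈ G} g • v` of a representation. -/
noncomputable def rnorm (ρ : Representation k G V) : V →ₗ[k] V := ∑ g : G, ρ g

lemma rnorm_mem_invariants (ρ : Representation k G V) (v : V) :
    rnorm ρ v ∈ ρ.invariants := by
  intro g
  show (ρ g) ((∑ h : G, ρ h) v) = _
  simp only [LinearMap.sum_apply, map_sum]
  rw [Fintype.sum_equiv (Equiv.mulLeft g) _ (fun h => ρ h v) (fun h => by
    rw [← Module.End.mul_apply, ← map_mul]; rfl)]
  simp [rnorm]

/-- The norm map, viewed as landing in the invariants. -/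
noncomputable def rnormRes (ρ : Representation k G V) : V →ₗ[k] ρ.invariants :=
  (rnorm ρ).codRestrict ρ.invariants (rnorm_mem_invariants ρ)

/-- The image of the norm map, inside the invariants. -/
noncomputable def rnormIm (ρ : Representation k G V) : Submodule k ρ.invariants :=
  LinearMap.range (rnormRes ρ)

/-- Degree-zero Tate cohomology of a representation: invariants modulo norms. -/
noncomputable def tate0 (ρ : Representation k G V) : Type :=
  ρ.invariants ⧸ rnormIm ρ

noncomputable instance (ρ : Representation k G V) : AddCommGroup (tate0 ρ) :=
  inferInstanceAs (AddCommGroup (ρ.invariants ⧸ rnormIm ρ))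

noncomputable instance (ρ : Representation k G V) : Module k (tate0 ρ) :=
  inferInstanceAs (Module k (ρ.invariants ⧸ rnormIm ρ))

/-- The Tate class of an invariant vector. -/
noncomputable def tate0mk {ρ : Representation k G V} (v : V) (hv : v ∈ ρ.invariants) :
    tate0 ρ := Submodule.Quotient.mk (⟨v, hv⟩ : ρ.invariants)

lemma invariants_comp {ρ : Representation k G V} {σ : Representation k G V₂}
    (f : V →ₗ[k] V₂) (hf : ∀ (g : G) (v : V), f (ρ g v) = σ g (f v)) :
    ∀ x ∈ ρ.invariants, f x ∈ σ.invariants := by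
  intro x hx g
  rw [← hf g x, hx g]

/-- Functoriality of degree-zero Tate cohomology along equivariant maps. -/
noncomputable def tate0map {ρ : Representation k G V} {σ : Representation k G V₂}
    (f : V →ₗ[k] V₂) (hf : ∀ (g : G) (v : V), f (ρ g v) = σ g (f v)) :
    tate0 ρ →ₗ[k] tate0 σ :=
  Submodule.mapQ (rnormIm ρ) (rnormIm σ) (f.restrict (invariants_comp f hf))
    (by
      rintro ⟨x, hx⟩ ⟨y, hy⟩
      refine ⟨f y, ?_⟩
      apply Subtype.ext
      have hy' := congrArg Subtype.val hy
      show rnorm σ (f y) = _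
      simp only [LinearMap.restrict_apply]
      have : rnorm σ (f y) = f (rnorm ρ y) := by
        simp only [rnorm, LinearMap.sum_apply, map_sum]
        exact Finset.sum_congr rfl fun g _ => (hf g y).symm
      rw [this]
      exact congrArg f hy')

end Aux

/-- Degree-zero Tate cohomology `Ĥ⁰(G, W) = W^G / N_G W` of an object of `Rep k G`. -/
noncomputable def H0T (W : Rep k G) : Type := tate0 W.ρ

noncomputable instance (W : Rep k G) : AddCommGroup (H0T W) :=
  inferInstanceAs (AddCommGroup (tate0 W.ρ))

noncomputable instance (W : Rep k G) : Module k (H0T W) :=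
  inferInstanceAs (Module k (tate0 W.ρ))

/-- Functoriality of `Ĥ⁰` along morphisms of representations. -/
noncomputable def H0Tmap {W W' : Rep k G} (ψ : W ⟶ W') : H0T W →ₗ[k] H0T W' :=
  tate0map ψ.hom (fun g v => Rep.hom_comm_apply ψ g v)

/-! ### The augmentation ideal and the syzygy modules `J n` -/

variable (G)

/-- The augmentation map `ℤ[G] → ℤ`. -/
noncomputable def aug : (G →₀ ℤ) →ₗ[ℤ] ℤ :=
  Finsupp.linearCombination ℤ (fun _ : G => (1 : ℤ))

lemma aug_comm (g : G) (x : G →₀ ℤ) :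
    aug G (Finsupp.lmapDomain ℤ ℤ (fun h : G => g • h) x) = aug G x := by
  unfold aug
  simp [Finsupp.linearCombination_apply]
  rw [Finsupp.sum_mapDomain_index] <;> simp

/-- The underlying `ℤ`-module of the augmentation ideal. -/
noncomputable abbrev IGcar : Type := LinearMap.ker (aug G)

/-- The representation of `G` on the augmentation ideal. -/
noncomputable def IGρ : Representation ℤ G (IGcar G) where
  toFun g := (Finsupp.lmapDomain ℤ ℤ (fun h : G => g • h)).restrict (p := LinearMap.ker (aug G))
    (q := LinearMap.ker (aug G)) (by
      intro x hx
      simp only [LinearMap.mem_ker] at hx ⊢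
      rw [aug_comm]; exact hx)
  map_one' := by ext x; simp [LinearMap.restrict_apply, ← Function.id_def]
  map_mul' g h := by ext x; simp [LinearMap.restrict_apply, Module.End.mul_apply, ← Finsupp.mapDomain_comp, Function.comp_def, mul_assoc]

/-- The augmentation ideal `I_G` of `ℤ[G]`, as an object of `Rep ℤ G`. -/
noncomputable def IGrep : Rep ℤ G := Rep.of (IGρ G)

/-- `Hom_ℤ(X, A)` with the conjugation `G`-action, i.e. the internal hom in `Rep ℤ G`. -/
noncomputable abbrev hRep {G : Type} [Group G] (X A : Rep.{0} ℤ G) : Rep.{0} ℤ G :=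
  (Rep.ihom X).obj A

/-- The `ℤ`-linear dual of the augmentation ideal, as an object of `Rep ℤ G`. -/
noncomputable def DIG : Rep ℤ G := hRep (IGrep G) (𝟙_ (Rep ℤ G))

instance : Module.Finite ℤ (IGcar G) := by
  have : Module.Finite ℤ (G →₀ ℤ) :=
    Module.Finite.equiv (Finsupp.linearEquivFunOnFinite ℤ ℤ G).symm
  exact Module.Finite.of_injective (LinearMap.ker (aug G)).subtype Subtype.val_injective

instance : Module.Free ℤ (IGcar G) := by infer_instance

/-- Nonnegative tensor powers `I_G^{⊗ n}` (with `I_G^{⊗ 0} = ℤ`). -/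
noncomputable def Jp : ℕ → Rep ℤ G
  | 0 => 𝟙_ (Rep ℤ G)
  | n + 1 => Jp n ⊗ IGrep G

/-- Tensor powers of the dual of the augmentation ideal. -/
noncomputable def Jn : ℕ → Rep ℤ G
  | 0 => 𝟙_ (Rep ℤ G)
  | n + 1 => Jn n ⊗ DIG G

/-- The standard syzygy modules of the trivial representation `ℤ`, indexed by `ℤ`:
`J n = I_G^{⊗ n}` for `n ≥ 0`, and `J n = (I_G^∨)^{⊗ (-n)}` for `n < 0`. -/
noncomputable def J : ℤ → Rep ℤ G
  | .ofNat n => Jp G n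
  | .negSucc n => Jn G (n + 1)

lemma J_ofNat (m : ℕ) : J G (m : ℤ) = Jp G m := rfl

lemma J_neg (m : ℕ) : J G (-(m : ℤ)) = Jn G m := by cases m <;> rfl

/-- The element of `(I_G)^∨ ⊗ I_G` corresponding to the identity map. -/
noncomputable def preElt : Module.Dual ℤ (IGcar G) ⊗[ℤ] IGcar G :=
  (dualTensorHomEquiv ℤ (IGcar G) (IGcar G)).symm LinearMap.id

/-- The canonical element of `I_G ⊗ (I_G)^∨` corresponding to the identity map. -/
noncomputable def coevElt : (IGrep G ⊗ DIG G).V :=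
  (TensorProduct.comm ℤ _ _) (preElt G)

lemma conj_dualTensor (g : G) (t : Module.Dual ℤ (IGcar G) ⊗[ℤ] IGcar G) :
    dualTensorHom ℤ _ _ (TensorProduct.map ((DIG G).ρ g) ((IGrep G).ρ g) t)
      = (IGrep G).ρ g ∘ₗ (dualTensorHom ℤ _ _ t) ∘ₗ (IGrep G).ρ g⁻¹ := by
  induction t with
  | zero =>
      refine (congrArg (dualTensorHom ℤ (IGcar G) (IGcar G)) (map_zero (TensorProduct.map ((DIG G).ρ g) ((IGrep G).ρ g)))).trans ?_
      exact ((map_zero (dualTensorHom ℤ (IGcar G) (IGcar G))).trans (LinearMap.comp_zero _).symm).trans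
        (congrArg (fun t => (IGρ G g) ∘ₗ t ∘ₗ (IGρ G g⁻¹)) (map_zero (dualTensorHom ℤ (IGcar G) (IGcar G))).symm)
  | tmul f v =>
      ext w
      exact (map_smul (IGρ G g) (f (IGρ G g⁻¹ w)) v).symm
  | add x y hx hy =>
      refine (congrArg (dualTensorHom ℤ (IGcar G) (IGcar G)) (map_add (TensorProduct.map ((DIG G).ρ g) ((IGrep G).ρ g)) x y)).trans ?_
      refine (map_add (dualTensorHom ℤ (IGcar G) (IGcar G)) _ _).trans ?_
      refine (congrArg₂ (· + ·) hx hy).trans ?_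
      refine Eq.trans ?_ (congrArg (fun t => (IGρ G g) ∘ₗ t ∘ₗ (IGρ G g⁻¹)) (map_add (dualTensorHom ℤ (IGcar G) (IGcar G)) x y).symm)
      exact ((congrArg (fun t => (IGρ G g) ∘ₗ t) (LinearMap.add_comp _ _ _)).trans (LinearMap.comp_add _ _ _)).symm

lemma coevElt_invariant (g : G) :
    ((IGrep G ⊗ DIG G).ρ g) (coevElt G) = coevElt G := by
  show TensorProduct.map ((IGrep G).ρ g) ((DIG G).ρ g)
      ((TensorProduct.comm ℤ _ _) (preElt G)) = _
  refine (TensorProduct.map_comm ((IGrep G).ρ g) ((DIG G).ρ g) (preElt G)).trans ?_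
  show (TensorProduct.comm ℤ _ _) (TensorProduct.map ((DIG G).ρ g) ((IGrep G).ρ g) (preElt G))
      = (TensorProduct.comm ℤ _ _) (preElt G)
  congr 1
  apply (dualTensorHomEquiv ℤ (IGcar G) (IGcar G)).injective
  have h2 : dualTensorHom ℤ (IGcar G) (IGcar G) (preElt G) = LinearMap.id :=
    (dualTensorHomEquiv ℤ (IGcar G) (IGcar G)).apply_symm_apply LinearMap.id
  show dualTensorHom ℤ (IGcar G) (IGcar G)
      (TensorProduct.map ((DIG G).ρ g) ((IGrep G).ρ g) (preElt G))
    = dualTensorHom ℤ (IGcar G) (IGcar G) (preElt G)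
  refine (conj_dualTensor G g (preElt G)).trans ?_
  show (IGrep G).ρ g ∘ₗ dualTensorHom ℤ (IGcar G) (IGcar G) (preElt G) ∘ₗ (IGrep G).ρ g⁻¹
      = dualTensorHom ℤ (IGcar G) (IGcar G) (preElt G)
  rw [h2]
  apply LinearMap.ext
  intro v
  exact (IGrep G).ρ.self_inv_apply g v

/-- The coevaluation `ℤ ⟶ I_G ⊗ I_G^∨`. -/
noncomputable def coev : 𝟙_ (Rep ℤ G) ⟶ IGrep G ⊗ DIG G := Rep.ofHom
  { toLinearMap := LinearMap.toSpanSingleton ℤ _ (coevElt G)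
    isIntertwining' := by
      intro g
      apply LinearMap.ext
      intro z
      show LinearMap.toSpanSingleton ℤ _ (coevElt G) ((𝟙_ (Rep ℤ G)).ρ g z)
          = ((IGrep G ⊗ DIG G).ρ g) (LinearMap.toSpanSingleton ℤ _ (coevElt G) z)
      have hz : ((𝟙_ (Rep ℤ G)).ρ g z) = z := rfl
      rw [hz]
      show z • coevElt G = ((IGrep G ⊗ DIG G).ρ g) (z • coevElt G)
      rw [map_smul, coevElt_invariant] }


variable {G}

/-- One-step comparison `J (n+1) ⟶ J n ⊗ I_G`. -/
noncomputable def sMap : ∀ n : ℤ, J G (n + 1) ⟶ J G n ⊗ IGrep G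
  | .ofNat m => 𝟙 (Jp G m ⊗ IGrep G)
  | .negSucc 0 =>
      coev G ≫ (β_ (IGrep G) (DIG G)).hom ≫ ((λ_ (DIG G)).inv ▷ IGrep G)
  | .negSucc (m+1) =>
      (ρ_ (Jn G (m+1))).inv ≫ (Jn G (m+1) ◁ (coev G ≫ (β_ (IGrep G) (DIG G)).hom))
        ≫ (α_ (Jn G (m+1)) (DIG G) (IGrep G)).inv

/-- One-step comparison `J (n-1) ⟶ J n ⊗ I_G^∨`. -/
noncomputable def tMap : ∀ n : ℤ, J G (n - 1) ⟶ J G n ⊗ DIG G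
  | .ofNat 0 => 𝟙 (𝟙_ (Rep ℤ G) ⊗ DIG G)
  | .ofNat (m+1) =>
      eqToHom (congrArg (J G) (show (Int.ofNat (m+1)) - 1 = ((m:ℕ) : ℤ) by
        rw [Int.ofNat_eq_coe]; push_cast; ring)) ≫
      (ρ_ (Jp G m)).inv ≫ (Jp G m ◁ coev G) ≫ (α_ (Jp G m) (IGrep G) (DIG G)).inv
  | .negSucc m => eqToHom (show J G (Int.negSucc m - 1) = J G (Int.negSucc m) ⊗ DIG G from rfl)

/-- Comparison maps `J (i + m) ⟶ J i ⊗ J m` for `m ≥ 0`. -/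
noncomputable def μpos (i : ℤ) : ∀ m : ℕ, J G (i + m) ⟶ J G i ⊗ J G (m : ℤ)
  | 0 => eqToHom (congrArg (J G) (by omega)) ≫ (ρ_ (J G i)).inv
  | m + 1 =>
      eqToHom (congrArg (J G) (show i + ((m:ℕ)+1:ℕ) = (i + m) + 1 by omega))
        ≫ sMap (i + m) ≫ (μpos i m ▷ IGrep G) ≫ (α_ (J G i) (J G (m:ℤ)) (IGrep G)).hom

/-- Comparison maps `J (i - m) ⟶ J i ⊗ J (-m)` for `m ≥ 0`. -/
noncomputable def μneg (i : ℤ) : ∀ m : ℕ, J G (i - m) ⟶ J G i ⊗ J G (-(m : ℤ))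
  | 0 => eqToHom (congrArg (J G) (by omega)) ≫ (ρ_ (J G i)).inv
  | m + 1 =>
      eqToHom (congrArg (J G) (show i - ((m:ℕ)+1:ℕ) = (i - m) - 1 by omega))
        ≫ tMap (i - m) ≫ (μneg i m ▷ DIG G) ≫ (α_ (J G i) (J G (-(m:ℤ))) (DIG G)).hom
        ≫ (J G i ◁ (eqToHom (show J G (-(m:ℤ)) ⊗ DIG G = J G (-((m:ℕ)+1:ℕ)) by
            rw [J_neg, J_neg]; rfl)))

variable (G)

/-- The canonical comparison map `J (i+j) ⟶ J i ⊗ J j`, implementing the standard stable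
equivalences between the syzygies `J`; it induces the cup product on Tate cohomology. -/
noncomputable def μ (i : ℤ) : ∀ j : ℤ, J G (i + j) ⟶ J G i ⊗ J G j
  | .ofNat m => μpos i m
  | .negSucc m =>
      eqToHom (congrArg (J G) (show i + Int.negSucc m = i - ((m+1 : ℕ) : ℤ) by
        rw [Int.negSucc_eq]; push_cast; ring))
        ≫ μneg i (m+1)

variable {G}

/-! ### Tate cohomology in all degrees, functoriality, cup products -/

/-- Tate cohomology `Ĥ^n(G, M)` of the finite group `G` with coefficients in `M : Rep ℤ G`,
realized as `Ĥ⁰(G, Hom_ℤ(J n, M))` for the standard `n`-th syzygy `J n` of `ℤ`. -/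
noncomputable def tate (n : ℤ) (M : Rep ℤ G) : Type := H0T (hRep (J G n) M)

noncomputable instance (n : ℤ) (M : Rep ℤ G) : AddCommGroup (tate n M) :=
  inferInstanceAs (AddCommGroup (H0T (hRep (J G n) M)))

/-- The map on Tate cohomology induced by a morphism of representations. -/
noncomputable def tmap (n : ℤ) {M N : Rep ℤ G} (φ : M ⟶ N) : tate n M → tate n N :=
  H0Tmap ((Rep.ihom (J G n)).map φ)

/-- Transport of Tate cohomology along an equality of degrees. -/
noncomputable def tcast {i j : ℤ} {M : Rep ℤ G} (h : i = j) (z : tate i M) : tate j M :=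
  h ▸ z

lemma hom_invariant {X W : Rep.{0} ℤ G} (m : X ⟶ W) :
    m.hom.toLinearMap ∈ (hRep X W).ρ.invariants := by
  intro g
  show W.ρ g ∘ₗ m.hom.toLinearMap ∘ₗ X.ρ g⁻¹ = m.hom.toLinearMap
  exact LinearMap.ext fun v => (congrArg (W.ρ g) (Rep.hom_comm_apply m g⁻¹ v)).trans
    (W.ρ.self_inv_apply g (m.hom v))

/-- The Tate cohomology class of a `G`-equivariant map `J n ⟶ W`. -/
noncomputable def mkCls {n : ℤ} {W : Rep ℤ G} (m : J G n ⟶ W) : tate n W :=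
  tate0mk m.hom.toLinearMap (hom_invariant m)


lemma tensor_rho_eq (M N : Rep ℤ G) (g : G) :
    (M ⊗ N).ρ g = TensorProduct.map (M.ρ g) (N.ρ g) := rfl

lemma cup_invariance {i j : ℤ} {M N : Rep ℤ G}
    (f : ((hRep (J G i) M).ρ.invariants))
    (g : ((hRep (J G j) N).ρ.invariants)) :
    (TensorProduct.map f.1 g.1).comp ((μ G i j).hom.toLinearMap)
      ∈ (hRep (J G (i + j)) (M ⊗ N)).ρ.invariants := by
  intro gg
  have hf : M.ρ gg ∘ₗ f.1 ∘ₗ (J G i).ρ gg⁻¹ = f.1 := f.2 gg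
  have hg : N.ρ gg ∘ₗ g.1 ∘ₗ (J G j).ρ gg⁻¹ = g.1 := g.2 gg
  have hμ : (μ G i j).hom.toLinearMap.comp ((J G (i + j)).ρ gg⁻¹)
      = (TensorProduct.map ((J G i).ρ gg⁻¹) ((J G j).ρ gg⁻¹)).comp (μ G i j).hom.toLinearMap := by
    have h := (μ G i j).hom.isIntertwining' gg⁻¹
    exact h
  show (M ⊗ N).ρ gg ∘ₗ ((TensorProduct.map f.1 g.1).comp (μ G i j).hom.toLinearMap)
        ∘ₗ (J G (i + j)).ρ gg⁻¹
      = (TensorProduct.map f.1 g.1).comp (μ G i j).hom.toLinearMap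
  have key : ∀ (u : (J G i).V →ₗ[ℤ] M.V) (w : (J G j).V →ₗ[ℤ] N.V),
      (M ⊗ N).ρ gg ∘ₗ ((TensorProduct.map u w).comp (μ G i j).hom.toLinearMap)
        ∘ₗ (J G (i + j)).ρ gg⁻¹
      = (TensorProduct.map (M.ρ gg ∘ₗ u ∘ₗ (J G i).ρ gg⁻¹)
          (N.ρ gg ∘ₗ w ∘ₗ (J G j).ρ gg⁻¹)).comp (μ G i j).hom.toLinearMap := by
    intro u w
    rw [LinearMap.comp_assoc, hμ, ← LinearMap.comp_assoc, ← LinearMap.comp_assoc]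
    rw [TensorProduct.map_comp, TensorProduct.map_comp]
    rfl
  exact (key f.1 g.1).trans
    (congrArg₂ (fun (u : (J G i).V →ₗ[ℤ] M.V) (w : (J G j).V →ₗ[ℤ] N.V) =>
      (TensorProduct.map u w).comp (μ G i j).hom.toLinearMap) hf hg)

lemma conj_term {i j : ℤ} {M N : Rep ℤ G} (u : (J G i).V →ₗ[ℤ] M.V)
    (w : (J G j).V →ₗ[ℤ] N.V) (h : G) :
    (TensorProduct.map (M.ρ h ∘ₗ u ∘ₗ (J G i).ρ h⁻¹) (N.ρ h ∘ₗ w ∘ₗ (J G j).ρ h⁻¹)).comp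
        (μ G i j).hom.toLinearMap
      = ((hRep (J G (i + j)) (M ⊗ N)).ρ h) ((TensorProduct.map u w).comp (μ G i j).hom.toLinearMap) := by
  have hμ : (μ G i j).hom.toLinearMap ∘ₗ (J G (i + j)).ρ h⁻¹
      = TensorProduct.map ((J G i).ρ h⁻¹) ((J G j).ρ h⁻¹) ∘ₗ (μ G i j).hom.toLinearMap := by
    have hc := (μ G i j).hom.isIntertwining' h⁻¹
    exact hc
  show _ = (M ⊗ N).ρ h ∘ₗ ((TensorProduct.map u w).comp (μ G i j).hom.toLinearMap) ∘ₗ (J G (i + j)).ρ h⁻¹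
  rw [LinearMap.comp_assoc, hμ, ← LinearMap.comp_assoc, ← LinearMap.comp_assoc]
  rw [TensorProduct.map_comp, TensorProduct.map_comp]
  rfl

lemma cup_norm_left {i j : ℤ} {M N : Rep ℤ G} (u : (J G i).V →ₗ[ℤ] M.V)
    (g : ((hRep (J G j) N).ρ.invariants)) :
    (TensorProduct.map (rnorm ((hRep (J G i) M).ρ) u) g.1).comp (μ G i j).hom.toLinearMap
      = rnorm ((hRep (J G (i + j)) (M ⊗ N)).ρ)
          ((TensorProduct.map u g.1).comp (μ G i j).hom.toLinearMap) := by
  have h1 : rnorm ((hRep (J G i) M).ρ) u = ∑ h : G, ((hRep (J G i) M).ρ h) u := by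
    exact LinearMap.sum_apply _ _ _
  have h2 : rnorm ((hRep (J G (i + j)) (M ⊗ N)).ρ) ((TensorProduct.map u g.1).comp (μ G i j).hom.toLinearMap)
      = ∑ h : G, ((hRep (J G (i + j)) (M ⊗ N)).ρ h)
          ((TensorProduct.map u g.1).comp (μ G i j).hom.toLinearMap) := by
    exact LinearMap.sum_apply _ _ _
  let φ : ((J G i).V →ₗ[ℤ] M.V) →+ ((J G (i + j)).V →ₗ[ℤ] (M.V ⊗[ℤ] N.V)) :=
    AddMonoidHom.mk' (fun u => (TensorProduct.map u g.1).comp (μ G i j).hom.toLinearMap)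
      (fun a b => (congrArg (LinearMap.comp · (μ G i j).hom.toLinearMap)
        (TensorProduct.map_add_left a b g.1)).trans (LinearMap.add_comp _ _ _))
  refine (congrArg φ h1).trans ((map_sum φ _ _).trans (Eq.trans ?_ h2.symm))
  refine Finset.sum_congr rfl fun h _ => ?_
  have hginv : N.ρ h ∘ₗ g.1 ∘ₗ (J G j).ρ h⁻¹ = g.1 := g.2 h
  refine Eq.trans ?_ (conj_term u g.1 h)
  exact congrArg (fun t : (J G j).V →ₗ[ℤ] N.V =>
    (TensorProduct.map (M.ρ h ∘ₗ u ∘ₗ (J G i).ρ h⁻¹) t).comp (μ G i j).hom.toLinearMap) hginv.symm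

lemma cup_norm_right {i j : ℤ} {M N : Rep ℤ G}
    (f : ((hRep (J G i) M).ρ.invariants)) (w : (J G j).V →ₗ[ℤ] N.V) :
    (TensorProduct.map f.1 (rnorm ((hRep (J G j) N).ρ) w)).comp (μ G i j).hom.toLinearMap
      = rnorm ((hRep (J G (i + j)) (M ⊗ N)).ρ)
          ((TensorProduct.map f.1 w).comp (μ G i j).hom.toLinearMap) := by
  have h1 : rnorm ((hRep (J G j) N).ρ) w = ∑ h : G, ((hRep (J G j) N).ρ h) w := by
    exact LinearMap.sum_apply _ _ _
  have h2 : rnorm ((hRep (J G (i + j)) (M ⊗ N)).ρ) ((TensorProduct.map f.1 w).comp (μ G i j).hom.toLinearMap)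
      = ∑ h : G, ((hRep (J G (i + j)) (M ⊗ N)).ρ h)
          ((TensorProduct.map f.1 w).comp (μ G i j).hom.toLinearMap) := by
    exact LinearMap.sum_apply _ _ _
  let φ : ((J G j).V →ₗ[ℤ] N.V) →+ ((J G (i + j)).V →ₗ[ℤ] (M.V ⊗[ℤ] N.V)) :=
    AddMonoidHom.mk' (fun w => (TensorProduct.map f.1 w).comp (μ G i j).hom.toLinearMap)
      (fun a b => (congrArg (LinearMap.comp · (μ G i j).hom.toLinearMap)
        (TensorProduct.map_add_right f.1 a b)).trans (LinearMap.add_comp _ _ _))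
  refine (congrArg φ h1).trans ((map_sum φ _ _).trans (Eq.trans ?_ h2.symm))
  refine Finset.sum_congr rfl fun h _ => ?_
  have hfinv : M.ρ h ∘ₗ f.1 ∘ₗ (J G i).ρ h⁻¹ = f.1 := f.2 h
  refine Eq.trans ?_ (conj_term f.1 w h)
  exact congrArg (fun t : (J G i).V →ₗ[ℤ] M.V =>
    (TensorProduct.map t (N.ρ h ∘ₗ w ∘ₗ (J G j).ρ h⁻¹)).comp (μ G i j).hom.toLinearMap) hfinv.symm

lemma cup_welldef {i j : ℤ} {M N : Rep ℤ G}
    (a₁ : ((hRep (J G i) M).ρ.invariants)) (b₁ : ((hRep (J G j) N).ρ.invariants))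
    (a₂ : ((hRep (J G i) M).ρ.invariants)) (b₂ : ((hRep (J G j) N).ρ.invariants))
    (ha : a₁ - a₂ ∈ rnormIm ((hRep (J G i) M).ρ))
    (hb : b₁ - b₂ ∈ rnormIm ((hRep (J G j) N).ρ)) :
    tate0mk (ρ := (hRep (J G (i + j)) (M ⊗ N)).ρ)
        ((TensorProduct.map a₁.1 b₁.1).comp ((μ G i j).hom.toLinearMap)) (cup_invariance a₁ b₁)
      = tate0mk (ρ := (hRep (J G (i + j)) (M ⊗ N)).ρ)
        ((TensorProduct.map a₂.1 b₂.1).comp ((μ G i j).hom.toLinearMap)) (cup_invariance a₂ b₂) := by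
  obtain ⟨u, hu⟩ := ha
  obtain ⟨w, hw⟩ := hb
  have hu' : rnorm ((hRep (J G i) M).ρ) u = a₁.1 - a₂.1 := congrArg Subtype.val hu
  have hw' : rnorm ((hRep (J G j) N).ρ) w = b₁.1 - b₂.1 := congrArg Subtype.val hw
  have step1 : tate0mk (ρ := (hRep (J G (i + j)) (M ⊗ N)).ρ)
        ((TensorProduct.map a₁.1 b₁.1).comp ((μ G i j).hom.toLinearMap))
        (cup_invariance a₁ b₁)
      = tate0mk (ρ := (hRep (J G (i + j)) (M ⊗ N)).ρ)
        ((TensorProduct.map a₂.1 b₁.1).comp ((μ G i j).hom.toLinearMap)) (cup_invariance a₂ b₁) := by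
    refine (Submodule.Quotient.eq _).mpr ?_
    refine ⟨(TensorProduct.map u b₁.1).comp ((μ G i j).hom.toLinearMap), ?_⟩
    apply Subtype.ext
    have key := cup_norm_left u b₁
    let φ : ((J G i).V →ₗ[ℤ] M.V) →+ ((J G (i + j)).V →ₗ[ℤ] (M.V ⊗[ℤ] N.V)) :=
      AddMonoidHom.mk' (fun u => (TensorProduct.map u b₁.1).comp (μ G i j).hom.toLinearMap)
        (fun a b => (congrArg (LinearMap.comp · (μ G i j).hom.toLinearMap)
          (TensorProduct.map_add_left a b b₁.1)).trans (LinearMap.add_comp _ _ _))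
    refine key.symm.trans ?_
    show _ = (TensorProduct.map a₁.1 b₁.1).comp ((μ G i j).hom.toLinearMap)
        - (TensorProduct.map a₂.1 b₁.1).comp ((μ G i j).hom.toLinearMap)
    exact (congrArg φ hu').trans (map_sub φ a₁.1 a₂.1)
  have step2 : tate0mk (ρ := (hRep (J G (i + j)) (M ⊗ N)).ρ)
        ((TensorProduct.map a₂.1 b₁.1).comp ((μ G i j).hom.toLinearMap))
        (cup_invariance a₂ b₁)
      = tate0mk (ρ := (hRep (J G (i + j)) (M ⊗ N)).ρ)
        ((TensorProduct.map a₂.1 b₂.1).comp ((μ G i j).hom.toLinearMap)) (cup_invariance a₂ b₂) := by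
    refine (Submodule.Quotient.eq _).mpr ?_
    refine ⟨(TensorProduct.map a₂.1 w).comp ((μ G i j).hom.toLinearMap), ?_⟩
    apply Subtype.ext
    have key := cup_norm_right a₂ w
    let φ : ((J G j).V →ₗ[ℤ] N.V) →+ ((J G (i + j)).V →ₗ[ℤ] (M.V ⊗[ℤ] N.V)) :=
      AddMonoidHom.mk' (fun w => (TensorProduct.map a₂.1 w).comp (μ G i j).hom.toLinearMap)
        (fun a b => (congrArg (LinearMap.comp · (μ G i j).hom.toLinearMap)
          (TensorProduct.map_add_right a₂.1 a b)).trans (LinearMap.add_comp _ _ _))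
    refine key.symm.trans ?_
    show _ = (TensorProduct.map a₂.1 b₁.1).comp ((μ G i j).hom.toLinearMap)
        - (TensorProduct.map a₂.1 b₂.1).comp ((μ G i j).hom.toLinearMap)
    exact (congrArg φ hw').trans (map_sub φ b₁.1 b₂.1)
  exact step1.trans step2

/-- The cup product `Ĥ^i(G, M) × Ĥ^j(G, N) → Ĥ^{i+j}(G, M ⊗ N)` on Tate cohomology,
induced by the comparison maps `μ`. -/
noncomputable def cup {i j : ℤ} {M N : Rep ℤ G} (z₁ : tate i M) (z₂ : tate j N) :
    tate (i + j) (M ⊗ N) :=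
  Quotient.liftOn₂ z₁ z₂
    (fun f g => tate0mk ((TensorProduct.map f.1 g.1).comp ((μ G i j).hom.toLinearMap)) (cup_invariance f g))
    (fun a₁ b₁ a₂ b₂ ha hb => cup_welldef a₁ b₁ a₂ b₂
      ((Submodule.quotientRel_def _).mp ha) ((Submodule.quotientRel_def _).mp hb))

/-! ### Pairings -/

/-- The composition pairing `Hom_ℤ(B, C) ⊗ Hom_ℤ(A, B) ⟶ Hom_ℤ(A, C)`, `f ⊗ φ ↦ f ∘ φ`. -/
noncomputable def compPair (A B C : Rep ℤ G) : hRep B C ⊗ hRep A B ⟶ hRep A C :=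
  MonoidalClosed.curry <|
    (A ◁ (β_ (hRep B C) (hRep A B)).hom) ≫ (α_ A (hRep A B) (hRep B C)).inv
      ≫ (((ihom.ev A).app B) ▷ hRep B C) ≫ (ihom.ev B).app C

/-- The evaluation pairing `Hom_ℤ(X, B) ⊗ X ⟶ B`, `f ⊗ x ↦ f x`. -/
noncomputable def evPair (X B : Rep ℤ G) : hRep X B ⊗ X ⟶ B :=
  (β_ (hRep X B) X).hom ≫ (ihom.ev X).app B

/-- The cup product `Ĥ^i(G, Hom(X, A)) × Ĥ^j(G, Hom(X', X)) → Ĥ^{i+j}(G, Hom(X', A))`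
induced by the composition pairing. -/
noncomputable def ccup {i j : ℤ} {X X' A : Rep ℤ G}
    (z : tate i (hRep X A)) (x : tate j (hRep X' X)) : tate (i + j) (hRep X' A) :=
  tmap (i + j) (compPair X' X A) (cup z x)

/-- `ccup`, with the degree of the target adjusted along an equality of integers. -/
noncomputable def ccupTo {i j m : ℤ} {X X' A : Rep ℤ G}
    (z : tate i (hRep X A)) (x : tate j (hRep X' X)) (h : i + j = m) :
    tate m (hRep X' A) :=
  tcast h (ccup z x)

/-- The class of the identity in `Ĥ⁰(G, Hom_ℤ(X, X))`. -/
noncomputable def idCls (X : Rep ℤ G) : tate 0 (hRep X X) :=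
  mkCls (MonoidalClosed.curry (ρ_ X).hom)

/-! ### Encoding pairs and related notions -/

/-- `(X, X')` is an *`r`-encoding pair* if for some `i ∈ ℤ` there is a natural isomorphism
of functors `Ĥ^i(G, Hom_ℤ(X, -)) ≅ Ĥ^{i+r}(G, Hom_ℤ(X', -))` on `Rep ℤ G`. -/
def IsEncodingPair {G : Type} [Group G] [Fintype G] (r : ℤ) (X X' : Rep ℤ G) : Prop :=
  ∃ (i : ℤ) (e : ∀ A : Rep ℤ G, tate i (hRep X A) ≃+ tate (i + r) (hRep X' A)),
    ∀ {A B : Rep ℤ G} (φ : A ⟶ B) (z : tate i (hRep X A)),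
      e B (tmap i ((Rep.ihom X).map φ) z) = tmap (i + r) ((Rep.ihom X').map φ) (e A z)

/-- `x ∈ Ĥ^r(G, Hom_ℤ(X', X))` is an *encoding element* for the pair `(X, X')` if it has a
*decoding element* `x' ∈ Ĥ^{-r}(G, Hom_ℤ(X, X'))` with `x' ∪ x = [id_{X'}]` and
`x ∪ x' = [id_X]`. -/
def IsEncodingElement {G : Type} [Group G] [Fintype G] {r : ℤ} (X X' : Rep ℤ G)
    (x : tate r (hRep X' X)) : Prop :=
  ∃ x' : tate (-r) (hRep X X'),
    ccupTo x' x (by ring) = idCls X' ∧ ccupTo x x' (by ring) = idCls X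

/-- The induced `G`-module `ℤ[G] ⊗_ℤ A ≅ (G →₀ A)`, with `G` acting by left translation. -/
noncomputable def indRep (G : Type) [Group G] (A : Type) [AddCommGroup A] [Module ℤ A] :
    Rep ℤ G :=
  Rep.of (G := G) (X := G →₀ A)
    { toFun := fun g => Finsupp.lmapDomain A ℤ (fun h => g * h)
      map_one' := by
        ext x h
        simp [Finsupp.lmapDomain_apply, Finsupp.mapDomain_id, one_mul]
      map_mul' := fun g g' => by
        ext x h
        simp [Finsupp.lmapDomain_apply, Module.End.mul_apply, Finsupp.mapDomain_single,
          mul_assoc] }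

/-- A `G`-module is *induced* if it is isomorphic to `ℤ[G] ⊗_ℤ A` for some abelian group `A`. -/
def IsInduced {G : Type} [Group G] (M : Rep ℤ G) : Prop :=
  ∃ (A : Type) (_ : AddCommGroup A) (_ : Module ℤ A), Nonempty (M ≅ indRep G A)

/-- A class `φ ∈ Ĥ⁰(G, Hom_ℤ(X, X))` is a unit for the (composition) cup product. -/
def IsUnitCls {G : Type} [Group G] [Fintype G] {X : Rep ℤ G}
    (φ : tate 0 (hRep X X)) : Prop :=
  ∃ ψ : tate 0 (hRep X X),
    ccupTo φ ψ (by ring) = idCls X ∧ ccupTo ψ φ (by ring) = idCls X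


/-- The natural map `Hom_ℤ(X, A) ⊗ I_G ⟶ Hom_ℤ(X, A ⊗ I_G)`, `f ⊗ z ↦ (x ↦ f x ⊗ z)`. -/
noncomputable def pr0 (X A : Rep ℤ G) : hRep X A ⊗ IGrep G ⟶ hRep X (A ⊗ IGrep G) :=
  MonoidalClosed.curry ((α_ X (hRep X A) (IGrep G)).inv ≫ ((ihom.ev X).app A ▷ IGrep G))

/-- The natural evaluation map `Hom_ℤ(X, Hom_ℤ(I_G, A)) ⊗ I_G ⟶ Hom_ℤ(X, A)`,
`f ⊗ z ↦ (x ↦ f x z)`. -/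
noncomputable def pr1 (X A : Rep ℤ G) :
    hRep X (hRep (IGrep G) A) ⊗ IGrep G ⟶ hRep X A :=
  MonoidalClosed.curry ((α_ X (hRep X (hRep (IGrep G) A)) (IGrep G)).inv
    ≫ ((ihom.ev X).app (hRep (IGrep G) A) ▷ IGrep G) ≫ evPair (IGrep G) A)

/-- The natural evaluation map `Hom_ℤ(X', X) ⊗ (X' ⊗ A) ⟶ X ⊗ A`. -/
noncomputable def tPair (X' X A : Rep ℤ G) : hRep X' X ⊗ (X' ⊗ A) ⟶ X ⊗ A :=
  (α_ (hRep X' X) X' A).inv ≫ (evPair X' X ▷ A)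

/-- A functor `Rep ℤ G ⥤ Rep ℤ G` sends `ℤ`-split short exact sequences of `G`-modules to
short exact sequences of `G`-modules. -/
def PreservesZSplitSES {G : Type} [Group G] (F : Rep.{0} ℤ G ⥤ Rep.{0} ℤ G) : Prop :=
  ∀ (A B C : Rep ℤ G) (f : A ⟶ B) (g : B ⟶ C),
    Function.Injective f.hom → Function.Surjective g.hom → Function.Exact f.hom g.hom →
    (∃ s : C.V →+ B.V, ∀ x, g.hom (s x) = x) →
    Function.Injective (F.map f).hom ∧ Function.Surjective (F.map g).hom ∧
      Function.Exact (F.map f).hom (F.map g).hom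

/-- A *shiftable functor*: it sends `ℤ`-split short exact sequences of `G`-modules to short
exact sequences, and sends induced modules to induced modules. -/
def Shiftable {G : Type} [Group G] (F : Rep ℤ G ⥤ Rep ℤ G) : Prop :=
  PreservesZSplitSES F ∧ ∀ M : Rep ℤ G, IsInduced M → IsInduced (F.obj M)

end Enc

open CategoryTheory MonoidalCategory Enc


namespace EncAux

variable {G : Type} [Group G] [Fintype G]

/-- Two morphisms agree up to a norm. -/
def Rel {A B : Rep.{0} ℤ G} (f g : A ⟶ B) : Prop :=
  ∃ u : A.V →ₗ[ℤ] B.V, ∀ x, f.hom x = g.hom x + ∑ a : G, B.ρ a (u (A.ρ a⁻¹ x))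

lemma Rel.refl {A B : Rep.{0} ℤ G} (f : A ⟶ B) : Rel f f := ⟨0, fun x => by simp⟩

lemma Rel.of_eq {A B : Rep.{0} ℤ G} {f g : A ⟶ B} (h : f = g) : Rel f g := h ▸ Rel.refl f

lemma Rel.symm {A B : Rep.{0} ℤ G} {f g : A ⟶ B} (h : Rel f g) : Rel g f := by
  obtain ⟨u, hu⟩ := h
  exact ⟨-u, fun x => by rw [hu x]; simp⟩

lemma Rel.trans {A B : Rep.{0} ℤ G} {f g h : A ⟶ B} (h₁ : Rel f g) (h₂ : Rel g h) :
    Rel f h := by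
  obtain ⟨u, hu⟩ := h₁
  obtain ⟨v, hv⟩ := h₂
  exact ⟨u + v, fun x => by
    rw [hu x, hv x]; simp only [LinearMap.add_apply, map_add, Finset.sum_add_distrib]; abel⟩

lemma Rel.add {A B : Rep.{0} ℤ G} {f g f' g' : A ⟶ B} (h₁ : Rel f g) (h₂ : Rel f' g') :
    Rel (f + f') (g + g') := by
  obtain ⟨u, hu⟩ := h₁
  obtain ⟨v, hv⟩ := h₂
  refine ⟨u + v, fun x => ?_⟩
  have e1 : (f + f').hom x = f.hom x + f'.hom x := rfl
  have e2 : (g + g').hom x = g.hom x + g'.hom x := rfl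
  rw [e1, e2, hu x, hv x]
  simp only [LinearMap.add_apply, map_add, Finset.sum_add_distrib]; abel

lemma Rel.comp_right {A B C : Rep.{0} ℤ G} {f g : A ⟶ B} (h : Rel f g) (k : B ⟶ C) :
    Rel (f ≫ k) (g ≫ k) := by
  obtain ⟨u, hu⟩ := h
  refine ⟨k.hom.toLinearMap ∘ₗ u, fun x => ?_⟩
  have e1 : (f ≫ k).hom x = k.hom (f.hom x) := rfl
  have e2 : (g ≫ k).hom x = k.hom (g.hom x) := rfl
  rw [e1, e2, hu x, map_add, map_sum]
  congr 1
  exact Finset.sum_congr rfl fun a _ => Rep.hom_comm_apply k a _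

lemma Rel.comp_left {A B C : Rep.{0} ℤ G} {f g : B ⟶ C} (k : A ⟶ B) (h : Rel f g) :
    Rel (k ≫ f) (k ≫ g) := by
  obtain ⟨u, hu⟩ := h
  refine ⟨u ∘ₗ k.hom.toLinearMap, fun x => ?_⟩
  have e1 : (k ≫ f).hom x = f.hom (k.hom x) := rfl
  have e2 : (k ≫ g).hom x = g.hom (k.hom x) := rfl
  rw [e1, e2, hu]
  congr 1
  exact Finset.sum_congr rfl fun a _ =>
    congrArg (fun t => C.ρ a (u t)) (Rep.hom_comm_apply k a⁻¹ x).symm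

lemma Rel.whiskerLeft {A B : Rep.{0} ℤ G} {f g : A ⟶ B} (Z : Rep.{0} ℤ G) (h : Rel f g) :
    Rel (Z ◁ f) (Z ◁ g) := by
  obtain ⟨u, hu⟩ := h
  refine ⟨TensorProduct.map LinearMap.id u, fun x => ?_⟩
  have key : (TensorProduct.map (LinearMap.id (R := ℤ) (M := Z.V)) f.hom.toLinearMap)
      = TensorProduct.map (LinearMap.id (R := ℤ) (M := Z.V)) g.hom.toLinearMap
        + ∑ a : G, TensorProduct.map (Z.ρ a) (B.ρ a) ∘ₗ TensorProduct.map LinearMap.id u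
          ∘ₗ TensorProduct.map (Z.ρ a⁻¹) (A.ρ a⁻¹) := by
    apply TensorProduct.ext'
    intro z y
    have hy : f.hom.toLinearMap y = g.hom.toLinearMap y
      + ∑ a : G, B.ρ a (u (A.ρ a⁻¹ y)) := hu y
    simp only [TensorProduct.map_tmul, LinearMap.add_apply, LinearMap.sum_apply,
      LinearMap.comp_apply, LinearMap.id_apply, hy, TensorProduct.tmul_add,
      TensorProduct.tmul_sum, Representation.self_inv_apply]
  have := LinearMap.congr_fun key x
  rw [LinearMap.add_apply, LinearMap.sum_apply] at this
  exact this

/-- Isomorphism in the stable category. -/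
def St (A B : Rep.{0} ℤ G) : Prop :=
  ∃ (f : A ⟶ B) (g : B ⟶ A), Rel (f ≫ g) (𝟙 A) ∧ Rel (g ≫ f) (𝟙 B)

lemma St.of_iso {A B : Rep.{0} ℤ G} (e : A ≅ B) : St A B :=
  ⟨e.hom, e.inv, Rel.of_eq e.hom_inv_id, Rel.of_eq e.inv_hom_id⟩

lemma St.refl (A : Rep.{0} ℤ G) : St A A := St.of_iso (Iso.refl A)

lemma St.of_eq {A B : Rep.{0} ℤ G} (e : A = B) : St A B := e ▸ St.refl A

lemma St.symm {A B : Rep.{0} ℤ G} (h : St A B) : St B A := by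
  obtain ⟨f, g, h1, h2⟩ := h
  exact ⟨g, f, h2, h1⟩

lemma St.trans {A B C : Rep.{0} ℤ G} (h : St A B) (k : St B C) : St A C := by
  obtain ⟨f, g, h1, h2⟩ := h
  obtain ⟨f', g', h1', h2'⟩ := k
  refine ⟨f ≫ f', g' ≫ g, ?_, ?_⟩
  · have := (h1'.comp_right g).comp_left f
    simp only [Category.assoc, Category.id_comp] at this ⊢
    exact this.trans h1
  · have := (h2.comp_right f').comp_left g'
    simp only [Category.assoc, Category.id_comp] at this ⊢
    exact this.trans h2'

lemma St.wl {A B : Rep.{0} ℤ G} (Z : Rep.{0} ℤ G) (h : St A B) : St (Z ⊗ A) (Z ⊗ B) := by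
  obtain ⟨f, g, h1, h2⟩ := h
  refine ⟨Z ◁ f, Z ◁ g, ?_, ?_⟩
  · have := h1.whiskerLeft Z
    simpa only [MonoidalCategory.whiskerLeft_comp, MonoidalCategory.whiskerLeft_id] using this
  · have := h2.whiskerLeft Z
    simpa only [MonoidalCategory.whiskerLeft_comp, MonoidalCategory.whiskerLeft_id] using this

lemma St.comm (A B : Rep.{0} ℤ G) : St (A ⊗ B) (B ⊗ A) := St.of_iso (β_ A B)

lemma St.assoc (A B C : Rep.{0} ℤ G) : St ((A ⊗ B) ⊗ C) (A ⊗ (B ⊗ C)) := St.of_iso (α_ A B C)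

lemma St.wr {A B : Rep.{0} ℤ G} (Z : Rep.{0} ℤ G) (h : St A B) : St (A ⊗ Z) (B ⊗ Z) :=
  (St.comm A Z).trans ((h.wl Z).trans (St.comm Z B))

lemma St.tensor {A B A' B' : Rep.{0} ℤ G} (h : St A B) (h' : St A' B') :
    St (A ⊗ A') (B ⊗ B') := (h.wr A').trans (h'.wl B)

lemma St.biprod {A B A' B' : Rep.{0} ℤ G} (h : St A B) (h' : St A' B') :
    St (A ⊞ A') (B ⊞ B') := by
  obtain ⟨f, g, h1, h2⟩ := h
  obtain ⟨f', g', h1', h2'⟩ := h'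
  have aux : ∀ {A A' : Rep.{0} ℤ G} {p : A ⟶ A} {q : A' ⟶ A'}, Rel p (𝟙 A) → Rel q (𝟙 A') →
      Rel (Limits.biprod.map p q) (𝟙 (A ⊞ A')) := by
    intro A A' p q hp hq
    have := ((hp.comp_right Limits.biprod.inl).comp_left (Limits.biprod.fst (Y := A'))).add
      ((hq.comp_right Limits.biprod.inr).comp_left (Limits.biprod.snd (X := A)))
    simp only [Category.id_comp, Limits.biprod.total] at this
    rwa [Limits.biprod.map_eq]
  refine ⟨Limits.biprod.map f f', Limits.biprod.map g g', ?_, ?_⟩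
  · have e : Limits.biprod.map f f' ≫ Limits.biprod.map g g'
        = Limits.biprod.map (f ≫ g) (f' ≫ g') := by
      apply Limits.biprod.hom_ext <;> simp
    rw [e]; exact aux h1 h1'
  · have e : Limits.biprod.map g g' ≫ Limits.biprod.map f f'
        = Limits.biprod.map (g ≫ f) (g' ≫ f') := by
      apply Limits.biprod.hom_ext <;> simp
    rw [e]; exact aux h2 h2'

lemma St.distrib (Z A B : Rep.{0} ℤ G) : St (Z ⊗ (A ⊞ B)) ((Z ⊗ A) ⊞ (Z ⊗ B)) :=
  haveI := Limits.preservesBinaryBiproducts_of_preservesBiproducts (tensorLeft Z)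
  St.of_iso ((tensorLeft Z).mapBiprod A B)



/-- The element `a - b` of the augmentation ideal. -/
noncomputable def dd (a b : G) : IGcar G :=
  ⟨Finsupp.single a 1 - Finsupp.single b 1, by simp [aug]⟩

lemma dd_val (a b c : G) : (dd a b).1 c = Finsupp.single a (1:ℤ) c - Finsupp.single b 1 c := rfl

lemma dd_sub (a b c : G) : dd a b = dd a c - dd b c := by
  apply Subtype.ext
  simp [dd]

lemma sum_coeff (x : IGcar G) : ∑ a : G, x.1 a = 0 := by
  have : Finsupp.linearCombination ℤ (fun _ : G => (1 : ℤ)) x.1 = 0 := x.2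
  rw [Finsupp.linearCombination_apply, Finsupp.sum_fintype _ _ (by simp)] at this
  simpa using this

lemma expand (x : IGcar G) (k : G) : x = ∑ h : G, x.1 h • dd h k := by
  classical
  apply Subtype.ext
  ext c
  rw [AddSubmonoidClass.coe_finsetSum, Finsupp.finsetSum_apply]
  have : ∀ h : G, ((x.1 h • dd h k : IGcar G) : G →₀ ℤ) c
      = x.1 h * Finsupp.single h (1:ℤ) c - x.1 h * Finsupp.single k (1:ℤ) c := by
    intro h
    show x.1 h • ((dd h k).1 c) = _
    rw [dd_val, smul_eq_mul, mul_sub]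
  simp only [this]
  rw [Finset.sum_sub_distrib, ← Finset.sum_mul, sum_coeff]
  simp [Finsupp.single_apply]

lemma IGρ_val (g : G) (x : IGcar G) (c : G) : (IGρ G g x).1 c = x.1 (g⁻¹ * c) := by
  show Finsupp.mapDomain (fun h : G => g • h) x.1 c = _
  have : c = g • (g⁻¹ * c) := by simp
  conv_lhs => rw [this]
  exact Finsupp.mapDomain_apply (MulAction.injective g) _ _

open Classical in
lemma IGρ_dd (g a b : G) : IGρ G g (dd a b) = dd (g * a) (g * b) := by
  apply Subtype.ext
  ext c
  rw [IGρ_val, dd_val, dd_val]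
  simp [Finsupp.single_apply, eq_inv_mul_iff_mul_eq]

/-- Coefficient functional. -/
noncomputable def cf (a : G) : IGcar G →ₗ[ℤ] ℤ :=
  Finsupp.lapply a ∘ₗ (LinearMap.ker (aug G)).subtype

lemma cf_apply (a : G) (x : IGcar G) : cf a x = x.1 a := rfl

/-- The trace. -/
noncomputable def trM (G : Type) [Group G] [Fintype G] : (IGcar G →ₗ[ℤ] IGcar G) →ₗ[ℤ] ℤ :=
  ∑ a : G, cf a ∘ₗ LinearMap.applyₗ (dd a 1)

lemma trM_eq (f : IGcar G →ₗ[ℤ] IGcar G) (h : G) : trM G f = ∑ a : G, (f (dd a h)).1 a := by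
  have e : trM G f = ∑ a : G, (f (dd a 1)).1 a := by
    simp [trM, cf_apply]
  rw [e]
  have : ∀ a : G, (f (dd a h)).1 a = (f (dd a 1)).1 a - (f (dd h 1)).1 a := by
    intro a
    rw [dd_sub a h 1, map_sub]; rfl
  simp only [this, Finset.sum_sub_distrib, sum_coeff, sub_zero]

lemma trM_conj (g : G) (f : IGcar G →ₗ[ℤ] IGcar G) :
    trM G (IGρ G g ∘ₗ f ∘ₗ IGρ G g⁻¹) = trM G f := by
  rw [trM_eq _ 1, trM_eq f g⁻¹]
  refine Fintype.sum_equiv (Equiv.mulLeft g⁻¹) _ _ fun a => ?_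
  simp only [LinearMap.comp_apply]
  rw [IGρ_val, IGρ_dd]
  simp

lemma trM_id : trM G LinearMap.id = (Fintype.card G : ℤ) - 1 := by
  classical
  rw [trM_eq _ 1]
  simp [dd_val, Finsupp.single_apply]

/-- The contracting map. -/
noncomputable def TT (G : Type) [Group G] [Fintype G] :
    (IGcar G →ₗ[ℤ] IGcar G) →ₗ[ℤ] (IGcar G →ₗ[ℤ] IGcar G) :=
  ∑ h : G, (LinearMap.smulRightₗ (R := ℤ) (M := IGcar G) (M₂ := IGcar G) (cf h)) ∘ₗ
    (LinearMap.toSpanSingleton ℤ (IGcar G) (dd h 1)) ∘ₗ cf 1 ∘ₗ LinearMap.applyₗ (dd 1 h)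

lemma TT_apply (f : IGcar G →ₗ[ℤ] IGcar G) (x : IGcar G) :
    TT G f x = ∑ h : G, x.1 h • ((f (dd 1 h)).1 1 • dd h 1) := by
  simp [TT, cf_apply]
  exact Finset.sum_congr rfl fun h _ => smul_comm _ _ _

lemma TT_conj (a : G) (f : IGcar G →ₗ[ℤ] IGcar G) (x : IGcar G) :
    IGρ G a (TT G (IGρ G a⁻¹ ∘ₗ f ∘ₗ IGρ G a) (IGρ G a⁻¹ x))
      = ∑ h : G, x.1 h • ((f (dd a h)).1 a • dd h a) := by
  rw [TT_apply, map_sum]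
  refine Fintype.sum_equiv (Equiv.mulLeft a) _ _ fun h => ?_
  rw [map_smul, map_smul]
  simp only [LinearMap.comp_apply, IGρ_val, IGρ_dd]
  simp

lemma TT_norm (f : IGcar G →ₗ[ℤ] IGcar G) (x : IGcar G) :
    ∑ a : G, IGρ G a (TT G (IGρ G a⁻¹ ∘ₗ f ∘ₗ IGρ G a) (IGρ G a⁻¹ x))
      = f x + trM G f • x := by
  classical
  simp only [TT_conj]
  apply Subtype.ext
  ext k
  have hcf : ∀ y : IGcar G, (y : G →₀ ℤ) k = cf k y := fun _ => rfl
  rw [hcf, hcf]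
  have hfx : cf k (f x) = - ∑ h : G, x.1 h * cf k (f (dd k h)) := by
    conv_lhs => rw [expand x k]
    rw [map_sum, map_sum, ← Finset.sum_neg_distrib]
    refine Finset.sum_congr rfl fun h _ => ?_
    have : dd h k = - dd k h := by rw [dd_sub k h 1, dd_sub h k 1]; abel
    rw [map_smul, map_smul, this, map_neg, map_neg, smul_eq_mul, mul_neg]
  rw [map_add, hfx, map_smul, trM_eq f k]
  simp only [map_sum, map_smul, cf_apply, dd_val, smul_eq_mul, mul_sub, Finset.sum_sub_distrib]
  simp only [Finsupp.single_apply, mul_ite, mul_one, mul_zero, Finset.sum_ite_irrel,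
    Finset.sum_const_zero, Finset.sum_ite_eq', Finset.mem_univ, if_true, Finset.sum_mul]
  simp only [mul_comm]
  ring

/-- `End(I) ⟶ ℤ`, negative trace. -/
noncomputable def trHom (G : Type) [Group G] [Fintype G] :
    hRep (IGrep G) (IGrep G) ⟶ 𝟙_ (Rep.{0} ℤ G) := Rep.ofHom
  { toLinearMap := -trM G
    isIntertwining' := by
      intro g
      apply LinearMap.ext
      intro f
      exact congrArg Neg.neg (trM_conj g f) }

/-- `ℤ ⟶ End(I)`. -/
noncomputable def oneHom (G : Type) [Group G] [Fintype G] :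
    𝟙_ (Rep.{0} ℤ G) ⟶ hRep (IGrep G) (IGrep G) := Rep.ofHom
  { toLinearMap := LinearMap.toSpanSingleton ℤ (IGcar G →ₗ[ℤ] IGcar G) LinearMap.id
    isIntertwining' := by
      intro g
      apply LinearMap.ext
      intro z
      apply LinearMap.ext
      intro x
      show z • x = IGρ G g (z • IGρ G g⁻¹ x)
      rw [map_smul]
      exact congrArg (fun t : IGcar G => z • t) ((IGρ G).self_inv_apply g x).symm }

lemma sum_app (F : G → (IGcar G →ₗ[ℤ] IGcar G)) (x : IGcar G) :
    (∑ a : G, F a) x = ∑ a : G, F a x := LinearMap.sum_apply _ _ _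

lemma smul_aux {M : Type} [AddCommGroup M] (t : ℤ) (y x : M) :
    y = (-t) • x + (y + t • x) := by
  rw [neg_zsmul, add_comm, add_assoc, add_neg_cancel, add_zero]

lemma St.endI : St (hRep (IGrep G) (IGrep G)) (𝟙_ (Rep.{0} ℤ G)) := by
  refine ⟨trHom G, oneHom G, ?_, ?_⟩
  · refine Rel.symm ⟨TT G, fun (f : IGcar G →ₗ[ℤ] IGcar G) => ?_⟩
    apply LinearMap.ext
    intro (x : IGcar G)
    have h := TT_norm f x
    have e1 : DFunLike.coe (F := IGcar G →ₗ[ℤ] IGcar G) ((trHom G ≫ oneHom G).hom f) x = (-trM G f) • x := rfl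
    have e2 : DFunLike.coe (F := IGcar G →ₗ[ℤ] IGcar G) (∑ a : G, (hRep (IGrep G) (IGrep G)).ρ a (TT G
        ((hRep (IGrep G) (IGrep G)).ρ a⁻¹ f))) x
        = ∑ a : G, IGρ G a (TT G (IGρ G a⁻¹ ∘ₗ f ∘ₗ IGρ G a) (IGρ G a⁻¹ x)) := by
      refine (sum_app (fun a => (hRep (IGrep G) (IGrep G)).ρ a (TT G
        ((hRep (IGrep G) (IGrep G)).ρ a⁻¹ f))) x).trans (Finset.sum_congr rfl fun a _ => ?_)
      show IGρ G a (TT G (IGρ G a⁻¹ ∘ₗ f ∘ₗ IGρ G a⁻¹⁻¹) (IGρ G a⁻¹ x)) = _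
      rw [inv_inv]
    show f x = DFunLike.coe (F := IGcar G →ₗ[ℤ] IGcar G) ((trHom G ≫ oneHom G).hom f) x +
      DFunLike.coe (F := IGcar G →ₗ[ℤ] IGcar G) (∑ a : G, (hRep (IGrep G) (IGrep G)).ρ a (TT G
        ((hRep (IGrep G) (IGrep G)).ρ a⁻¹ f))) x
    rw [e1, e2, h]
    exact smul_aux _ _ _
  · refine ⟨-LinearMap.id, fun z => ?_⟩
    have key : ∀ z : ℤ, -trM G (z • LinearMap.id) = z + ∑ a : G, (-z) := by
      intro z
      rw [map_smul, trM_id]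
      simp
      ring
    exact key z

lemma St.DI : St (DIG G ⊗ IGrep G) (𝟙_ (Rep.{0} ℤ G)) := by
  refine St.trans ?_ St.endI
  refine St.of_iso (Rep.mkIso (ρ := (DIG G ⊗ IGrep G).ρ)
    (σ := (hRep (IGrep G) (IGrep G)).ρ) ?_)
  exact
    { toLinearMap := dualTensorHom ℤ (IGcar G) (IGcar G)
      isIntertwining' := fun g => LinearMap.ext fun t => conj_dualTensor G g t
      invFun := (dualTensorHomEquiv ℤ (IGcar G) (IGcar G)).symm
      left_inv := fun t => (dualTensorHomEquiv ℤ (IGcar G) (IGcar G)).symm_apply_apply t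
      right_inv := fun t => (dualTensorHomEquiv ℤ (IGcar G) (IGcar G)).apply_symm_apply t }

lemma St.ID : St (IGrep G ⊗ DIG G) (𝟙_ (Rep.{0} ℤ G)) := (St.comm _ _).trans St.DI

lemma St.J_succ : ∀ n : ℤ, St (J G (n + 1)) (J G n ⊗ IGrep G)
  | .ofNat m => St.refl (Jp G m ⊗ IGrep G)
  | .negSucc 0 => (St.DI.symm).trans (St.wr (IGrep G) (St.of_iso (λ_ (DIG G)).symm))
  | .negSucc (m+1) =>
      (St.of_iso (ρ_ (Jn G (m+1))).symm).trans
        ((St.wl (Jn G (m+1)) St.DI.symm).trans (St.assoc _ _ _).symm)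

lemma St.J_pred (n : ℤ) : St (J G (n - 1)) (J G n ⊗ DIG G) := by
  have h := St.J_succ (G := G) (n - 1)
  rw [sub_add_cancel] at h
  exact ((((h.wr (DIG G)).trans (St.assoc _ _ _)).trans (St.wl _ St.ID)).trans
    (St.of_iso (ρ_ _))).symm

lemma St.J_add (i j : ℤ) : St (J G (i + j)) (J G i ⊗ J G j) := by
  induction j using Int.induction_on with
  | zero =>
    rw [add_zero]
    exact St.of_iso (ρ_ (J G i)).symm
  | succ n ih =>
    rw [← add_assoc]
    exact (((St.J_succ _).trans (ih.wr _)).trans (St.assoc _ _ _)).trans (St.wl _ (St.J_succ _).symm)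
  | pred n ih =>
    rw [← add_sub_assoc]
    exact (((St.J_pred _).trans (ih.wr _)).trans (St.assoc _ _ _)).trans (St.wl _ (St.J_pred _).symm)

lemma St.J_zero (A : Rep.{0} ℤ G) : St (J G 0 ⊗ A) A := St.of_iso (λ_ A)



/-- The class of a morphism in degree-zero Tate cohomology of the internal hom. -/
noncomputable def cls {W A : Rep.{0} ℤ G} (f : W ⟶ A) : H0T (hRep W A) :=
  tate0mk f.hom.toLinearMap (hom_invariant f)

lemma cls_surj {W A : Rep.{0} ℤ G} (z : H0T (hRep W A)) : ∃ f : W ⟶ A, cls f = z := by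
  obtain ⟨⟨(v : W.V →ₗ[ℤ] A.V), hv⟩, rfl⟩ := Submodule.Quotient.mk_surjective _ z
  refine ⟨Rep.ofHom (ρ := W.ρ) (σ := A.ρ) { toLinearMap := v, isIntertwining' := ?_ }, rfl⟩
  intro g
  apply LinearMap.ext
  intro x
  have h : A.ρ g ∘ₗ v ∘ₗ W.ρ g⁻¹ = v := hv g
  have h2 : A.ρ g (v (W.ρ g⁻¹ (W.ρ g x))) = v (W.ρ g x) := LinearMap.congr_fun h (W.ρ g x)
  have h3 : A.ρ g (v x) = v (W.ρ g x) :=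
    (congrArg (fun t => A.ρ g (v t)) (W.ρ.inv_self_apply g x).symm).trans h2
  exact h3.symm

lemma rnorm_app {W A : Rep.{0} ℤ G} (u : W.V →ₗ[ℤ] A.V) (x : W.V) :
    DFunLike.coe (F := W.V →ₗ[ℤ] A.V) (rnorm (hRep W A).ρ u) x
      = ∑ a : G, A.ρ a (u (W.ρ a⁻¹ x)) := by
  have h1 : rnorm (hRep W A).ρ u = ∑ a : G, (A.ρ a ∘ₗ u ∘ₗ W.ρ a⁻¹) :=
    LinearMap.sum_apply _ _ _
  refine (congrArg (fun t : W.V →ₗ[ℤ] A.V => t x) h1).trans ?_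
  exact LinearMap.sum_apply _ _ _

lemma cls_eq {W A : Rep.{0} ℤ G} (f g : W ⟶ A) : cls f = cls g ↔ Rel f g := by
  refine (Submodule.Quotient.eq _).trans ?_
  constructor
  · rintro ⟨(u : W.V →ₗ[ℤ] A.V), hu⟩
    have hu' : rnorm (hRep W A).ρ u = f.hom.toLinearMap - g.hom.toLinearMap :=
      congrArg Subtype.val hu
    refine ⟨u, fun x => ?_⟩
    have h3 : f.hom x - g.hom x = ∑ a : G, A.ρ a (u (W.ρ a⁻¹ x)) :=
      (congrArg (fun t : W.V →ₗ[ℤ] A.V => t x) hu').symm.trans (rnorm_app u x)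
    rw [← h3]
    abel
  · rintro ⟨u, hu⟩
    refine ⟨u, Subtype.ext ?_⟩
    show rnorm (hRep W A).ρ u = f.hom.toLinearMap - g.hom.toLinearMap
    apply LinearMap.ext
    intro x
    refine (rnorm_app u x).trans ?_
    show _ = f.hom x - g.hom x
    rw [hu x]; abel

lemma H0Tmap_cls {W A B : Rep.{0} ℤ G} (φ : A ⟶ B) (f : W ⟶ A) :
    H0Tmap ((Rep.ihom W).map φ) (cls f) = cls (f ≫ φ) := rfl

/-- Precomposition on internal homs. -/
noncomputable def pre {k : Type} [CommRing k] {W W' : Rep.{0} k G} (h : W' ⟶ W) (A : Rep.{0} k G) :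
    (Rep.ihom W).obj A ⟶ (Rep.ihom W').obj A :=
  Rep.ofHom (ρ := ((Rep.ihom W).obj A).ρ) (σ := ((Rep.ihom W').obj A).ρ)
    { toLinearMap := LinearMap.lcomp k A.V h.hom.toLinearMap
      isIntertwining' := by
        intro g
        apply LinearMap.ext
        intro (f : W.V →ₗ[k] A.V)
        apply LinearMap.ext
        intro (x : W'.V)
        exact congrArg (fun t => A.ρ g (f t)) (Rep.hom_comm_apply h g⁻¹ x).symm }

lemma pre_cls {W W' A : Rep.{0} ℤ G} (h : W' ⟶ W) (f : W ⟶ A) :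
    H0Tmap (pre h A) (cls f) = cls (h ≫ f) := rfl

/-- Additive equivalence of Tate groups from mutually inverse maps. -/
noncomputable def mkEquiv {W W' : Rep.{0} ℤ G} (f : H0T W →ₗ[ℤ] H0T W') (g : H0T W' →ₗ[ℤ] H0T W)
    (h1 : ∀ x, g (f x) = x) (h2 : ∀ x, f (g x) = x) : H0T W ≃+ H0T W' where
  toFun := f
  invFun := g
  left_inv := h1
  right_inv := h2
  map_add' := map_add f

/-- The natural iso associated with a stable isomorphism. -/
lemma St.natural {W W' : Rep.{0} ℤ G} (h : St W W') :
    ∃ e : ∀ A : Rep.{0} ℤ G, H0T (hRep W A) ≃+ H0T (hRep W' A),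
      ∀ {A B : Rep.{0} ℤ G} (φ : A ⟶ B) (z : H0T (hRep W A)),
        e B (H0Tmap ((Rep.ihom W).map φ) z) = H0Tmap ((Rep.ihom W').map φ) (e A z) := by
  obtain ⟨f, g, h1, h2⟩ := h
  refine ⟨fun A => mkEquiv (H0Tmap (pre g A)) (H0Tmap (pre f A)) ?_ ?_, ?_⟩
  · intro x
    obtain ⟨k, rfl⟩ := cls_surj x
    rw [pre_cls, pre_cls, cls_eq]
    simpa using h1.comp_right k
  · intro x
    obtain ⟨k, rfl⟩ := cls_surj x
    rw [pre_cls, pre_cls, cls_eq]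
    simpa using h2.comp_right k
  · intro A B φ z
    obtain ⟨k, rfl⟩ := cls_surj z
    show H0Tmap (pre g B) (H0Tmap ((Rep.ihom W).map φ) (cls k)) =
      H0Tmap ((Rep.ihom W').map φ) (H0Tmap (pre g A) (cls k))
    rw [H0Tmap_cls, pre_cls, pre_cls, H0Tmap_cls, Category.assoc]

lemma St.of_natural {W W' : Rep.{0} ℤ G}
    (e : ∀ A : Rep.{0} ℤ G, H0T (hRep W A) ≃+ H0T (hRep W' A))
    (he : ∀ {A B : Rep.{0} ℤ G} (φ : A ⟶ B) (z : H0T (hRep W A)),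
        e B (H0Tmap ((Rep.ihom W).map φ) z) = H0Tmap ((Rep.ihom W').map φ) (e A z)) :
    St W W' := by
  obtain ⟨f, hf⟩ := cls_surj (e W (cls (𝟙 W)))
  obtain ⟨g, hg⟩ := cls_surj ((e W').symm (cls (𝟙 W')))
  have key : ∀ {A : Rep.{0} ℤ G} (k : W ⟶ A), e A (cls k) = cls (f ≫ k) := by
    intro A k
    have := he k (cls (𝟙 W))
    rwa [H0Tmap_cls, Category.id_comp, ← hf, H0Tmap_cls] at this
  refine ⟨g, f, ?_, ?_⟩
  · rw [← cls_eq]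
    apply (e W).injective
    rw [← hf, ← H0Tmap_cls, he, hg, AddEquiv.apply_symm_apply, H0Tmap_cls, Category.id_comp]
  · rw [← cls_eq, ← key, hg, AddEquiv.apply_symm_apply]

section Cur
variable {k : Type} [CommRing k]

/-- Uncurrying. -/
noncomputable def unc (P X A : Rep.{0} k G) :
    (Rep.ihom P).obj ((Rep.ihom X).obj A) ⟶ (Rep.ihom (P ⊗ X)).obj A :=
  Rep.ofHom (ρ := ((Rep.ihom P).obj ((Rep.ihom X).obj A)).ρ) (σ := ((Rep.ihom (P ⊗ X)).obj A).ρ)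
    { toLinearMap := (TensorProduct.lift.equiv (.id k) P.V X.V A.V).toLinearMap
      isIntertwining' := by
        intro g
        apply LinearMap.ext
        intro (f : P.V →ₗ[k] X.V →ₗ[k] A.V)
        apply TensorProduct.ext'
        intro p x
        rfl }

/-- Currying. -/
noncomputable def cur (P X A : Rep.{0} k G) :
    (Rep.ihom (P ⊗ X)).obj A ⟶ (Rep.ihom P).obj ((Rep.ihom X).obj A) :=
  Rep.ofHom (σ := ((Rep.ihom P).obj ((Rep.ihom X).obj A)).ρ) (ρ := ((Rep.ihom (P ⊗ X)).obj A).ρ)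
    { toLinearMap := (TensorProduct.lift.equiv (.id k) P.V X.V A.V).symm.toLinearMap
      isIntertwining' := by
        intro g
        apply LinearMap.ext
        intro (f : P.V ⊗[k] X.V →ₗ[k] A.V)
        apply LinearMap.ext
        intro (p : P.V)
        apply LinearMap.ext
        intro (x : X.V)
        rfl }

lemma unc_cur (P X A : Rep.{0} k G) : unc P X A ≫ cur P X A = 𝟙 _ := by
  apply Rep.hom_ext
  apply Representation.IntertwiningMap.ext
  exact LinearMap.ext (TensorProduct.lift.equiv (.id k) P.V X.V A.V).symm_apply_apply

lemma cur_unc (P X A : Rep.{0} k G) : cur P X A ≫ unc P X A = 𝟙 _ := by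
  apply Rep.hom_ext
  apply Representation.IntertwiningMap.ext
  exact LinearMap.ext (TensorProduct.lift.equiv (.id k) P.V X.V A.V).apply_symm_apply

lemma unc_nat (P X : Rep.{0} k G) {A B : Rep.{0} k G} (φ : A ⟶ B) :
    (Rep.ihom P).map ((Rep.ihom X).map φ) ≫ unc P X B
      = unc P X A ≫ (Rep.ihom (P ⊗ X)).map φ := by
  apply Rep.hom_ext
  apply Representation.IntertwiningMap.ext
  apply LinearMap.ext
  intro f
  apply TensorProduct.ext'
  intro p x
  rfl

end Cur

lemma H0Tmap_comp {A B C : Rep.{0} ℤ G} (f : A ⟶ B) (g : B ⟶ C) (z : H0T A) :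
    H0Tmap g (H0Tmap f z) = H0Tmap (f ≫ g) z := by
  obtain ⟨⟨v, hv⟩, rfl⟩ := Submodule.Quotient.mk_surjective _ z
  rfl

lemma H0Tmap_id {A : Rep.{0} ℤ G} (z : H0T A) : H0Tmap (𝟙 A) z = z := by
  obtain ⟨⟨v, hv⟩, rfl⟩ := Submodule.Quotient.mk_surjective _ z
  rfl

/-- Tate cohomology of an internal hom as stable morphisms. -/
noncomputable def tE (i : ℤ) (X A : Rep.{0} ℤ G) :
    tate i (hRep X A) ≃+ H0T (hRep (J G i ⊗ X) A) :=
  mkEquiv (H0Tmap (unc (J G i) X A)) (H0Tmap (cur (J G i) X A))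
    (fun x => by rw [H0Tmap_comp, unc_cur, H0Tmap_id])
    (fun x => by rw [H0Tmap_comp, cur_unc, H0Tmap_id])

lemma tE_nat (i : ℤ) (X : Rep.{0} ℤ G) {A B : Rep.{0} ℤ G} (φ : A ⟶ B) (z : tate i (hRep X A)) :
    tE i X B (tmap i ((Rep.ihom X).map φ) z)
      = H0Tmap ((Rep.ihom (J G i ⊗ X)).map φ) (tE i X A z) := by
  show H0Tmap (unc (J G i) X B) (H0Tmap _ z) = H0Tmap _ (H0Tmap (unc (J G i) X A) z)
  exact ((H0Tmap_comp _ _ _).trans (congrArg (fun t => H0Tmap t z) (unc_nat (J G i) X φ))).trans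
    (H0Tmap_comp _ _ _).symm

lemma enc_iff (r : ℤ) (X X' : Rep.{0} ℤ G) : IsEncodingPair r X X' ↔ St X (J G r ⊗ X') := by
  constructor
  · rintro ⟨i, e, he⟩
    have h : St (J G i ⊗ X) (J G (i + r) ⊗ X') := by
      refine St.of_natural (fun A => ((tE i X A).symm.trans (e A)).trans (tE (i + r) X' A)) ?_
      intro A B φ z
      obtain ⟨w, rfl⟩ := (tE i X A).surjective z
      simp only [AddEquiv.trans_apply]
      rw [← tE_nat, AddEquiv.symm_apply_apply, AddEquiv.symm_apply_apply, he, tE_nat]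
    have a : ∀ (j : ℤ) (Z : Rep.{0} ℤ G), St (J G (-i) ⊗ (J G j ⊗ Z)) (J G (-i + j) ⊗ Z) :=
      fun j Z => (St.assoc _ _ _).symm.trans ((St.J_add _ _).symm.wr Z)
    have h0 := a i X
    rw [neg_add_cancel] at h0
    have h1 := a (i + r) X'
    rw [neg_add_cancel_left] at h1
    exact (St.J_zero X).symm.trans (h0.symm.trans ((h.wl _).trans h1))
  · intro h
    have h' : St (J G 0 ⊗ X) (J G (0 + r) ⊗ X') := by
      rw [zero_add]; exact (St.J_zero X).trans h
    obtain ⟨e, he⟩ := h'.natural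
    refine ⟨0, fun A => ((tE 0 X A).trans (e A)).trans (tE (0 + r) X' A).symm, ?_⟩
    intro A B φ z
    simp only [AddEquiv.trans_apply]
    rw [AddEquiv.symm_apply_eq, tE_nat, he, tE_nat, AddEquiv.apply_symm_apply]

lemma St.J_move (r s : ℤ) (X Y : Rep.{0} ℤ G) (h : St X (J G r ⊗ Y)) (hs : s + r = 0) :
    St Y (J G s ⊗ X) := by
  have h1 := (h.wl (J G s)).trans ((St.assoc _ _ _).symm.trans ((St.J_add s r).symm.wr Y))
  rw [hs] at h1
  exact (h1.trans (St.J_zero Y)).symm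

end EncAux

theorem statement8 (G : Type) [Group G] [Fintype G] (r s : ℤ) (X X' Y Y' : Rep ℤ G)
    (hX : IsEncodingPair r X X') (hY : IsEncodingPair s Y Y') :
    IsEncodingPair (-r) X' X ∧
    (r = s → IsEncodingPair r (X ⊞ Y) (X' ⊞ Y')) ∧
    IsEncodingPair (r + s) (X ⊗ Y) (X' ⊗ Y') ∧
    (X' = Y → IsEncodingPair (r + s) X Y') := by
  open EncAux in
  simp only [enc_iff] at hX hY ⊢
  refine ⟨St.J_move r (-r) _ _ hX (neg_add_cancel r), ?_, ?_, ?_⟩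
  · rintro rfl
    exact (hX.biprod hY).trans (St.distrib _ _ _).symm
  · refine (hX.tensor hY).trans ?_
    refine St.trans ?_ ((St.J_add r s).symm.wr _)
    exact St.of_iso ⟨tensorμ (J G r) X' (J G s) Y', tensorδ (J G r) X' (J G s) Y',
      tensorμ_tensorδ _ _ _ _, tensorδ_tensorμ _ _ _ _⟩
  · rintro rfl
    exact hX.trans ((hY.wl _).trans ((St.assoc _ _ _).symm.trans ((St.J_add r s).symm.wr _)))
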